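/- Law of large numbers for the Bergman measures: assume each Q_k(α) is finite, fix ρ ∈ ℝ^m, and suppose there exist constants c, C > 0 such that for all k ≥ 1, Π_k(ρ) ≥ c k^m, |(∂/∂ρ_j) Π_k(ρ)| ≤ C k^m and |(∂²/∂ρ_i∂ρ_j) Π_k(ρ)| ≤ C k^m for all i,j. Then μ_k^ρ converges weakly to the Dirac mass δ_{∇φ(ρ)} at the moment-map image of ρ: for every continuous function f on P, ∫_P f dμ_k^ρ → f(∇φ(ρ)) as k → ∞. -/

import Mathlib

open MeasureTheory Real Filter
open scoped BigOperators Topology Classical ENNReal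

noncomputable section

/-- Euclidean dot product on `ℝ^m`. -/
def dotp {m : ℕ} (x y : Fin m → ℝ) : ℝ := ∑ i, x i * y i

/-- Euclidean norm on `ℝ^m`. -/
def enorm' {m : ℕ} (x : Fin m → ℝ) : ℝ := Real.sqrt (∑ i, x i ^ 2)

/-- Partial derivative `∂f/∂ρ_j`. -/
def pd {m : ℕ} (f : (Fin m → ℝ) → ℝ) (j : Fin m) (ρ : Fin m → ℝ) : ℝ :=
  fderiv ℝ f ρ (Pi.single j 1)

/-- Hessian matrix `(∂²f/∂ρ_i∂ρ_j)`. -/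
def hess {m : ℕ} (f : (Fin m → ℝ) → ℝ) (ρ : Fin m → ℝ) : Matrix (Fin m) (Fin m) ℝ :=
  Matrix.of fun i j => pd (fun ρ' => pd f j ρ') i ρ

/-- Gradient map `∇f : ℝ^m → ℝ^m`. -/
def gradMap {m : ℕ} (f : (Fin m → ℝ) → ℝ) (ρ : Fin m → ℝ) : Fin m → ℝ :=
  fun i => pd f i ρ

/-- The rescaled lattice point `α/k ∈ ℝ^m`. -/
def lpt {m : ℕ} (k : ℕ) (α : Fin m → ℤ) : Fin m → ℝ := fun i => (α i : ℝ) / k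

/-- The norming constant `Q_k(α) = ∫ e^{⟨α,ρ⟩ - kφ(ρ)} det(Hess φ(ρ)) dρ`. -/
def Qk {m : ℕ} (φ : (Fin m → ℝ) → ℝ) (k : ℕ) (α : Fin m → ℤ) : ℝ :=
  ∫ ρ : Fin m → ℝ, Real.exp (dotp (fun i => (α i : ℝ)) ρ - k * φ ρ) * (hess φ ρ).det

/-- The Bergman weight `w_{k,α}(ρ) = e^{⟨α,ρ⟩ - kφ(ρ)}/Q_k(α)` for `α ∈ kP ∩ ℤ^m`. -/
def wt {m : ℕ} (P : Set (Fin m → ℝ)) (φ : (Fin m → ℝ) → ℝ) (k : ℕ) (α : Fin m → ℤ)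
    (ρ : Fin m → ℝ) : ℝ :=
  if lpt k α ∈ P then Real.exp (dotp (fun i => (α i : ℝ)) ρ - k * φ ρ) / Qk φ k α else 0

/-- The Bergman density of states `Π_k(ρ) = Σ_{α ∈ kP∩ℤ^m} w_{k,α}(ρ)`. -/
def dos {m : ℕ} (P : Set (Fin m → ℝ)) (φ : (Fin m → ℝ) → ℝ) (k : ℕ) (ρ : Fin m → ℝ) : ℝ :=
  ∑' α : Fin m → ℤ, wt P φ k α ρ

lemma dotp_eq_clm {m : ℕ} (a : Fin m → ℝ) :
    dotp a = ⇑(∑ i, a i • (ContinuousLinearMap.proj i : (Fin m → ℝ) →L[ℝ] ℝ)) := by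
  ext x
  simp [dotp]

lemma differentiable_dotp {m : ℕ} (a : Fin m → ℝ) : Differentiable ℝ (dotp a) := by
  rw [dotp_eq_clm]
  exact ContinuousLinearMap.differentiable _

lemma pd_dotp {m : ℕ} (a : Fin m → ℝ) (j : Fin m) (ρ : Fin m → ℝ) :
    pd (dotp a) j ρ = a j := by
  unfold pd
  rw [dotp_eq_clm, ContinuousLinearMap.fderiv]
  simp [Pi.single_apply]

lemma pd_mul {m : ℕ} {f g : (Fin m → ℝ) → ℝ} {ρ : Fin m → ℝ} (hf : DifferentiableAt ℝ f ρ)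
    (hg : DifferentiableAt ℝ g ρ) (j : Fin m) :
    pd (fun x => f x * g x) j ρ = f ρ * pd g j ρ + g ρ * pd f j ρ := by
  unfold pd
  rw [fderiv_fun_mul hf hg]
  simp

lemma pd_sum {m : ℕ} {ι : Type*} {s : Finset ι} {f : ι → (Fin m → ℝ) → ℝ} {ρ : Fin m → ℝ}
    (hf : ∀ a ∈ s, DifferentiableAt ℝ (f a) ρ) (j : Fin m) :
    pd (fun x => ∑ a ∈ s, f a x) j ρ = ∑ a ∈ s, pd (f a) j ρ := by
  unfold pd
  rw [fderiv_fun_sum hf]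
  simp

lemma pd_const_sub_const_mul {m : ℕ} {g : (Fin m → ℝ) → ℝ} {ρ : Fin m → ℝ}
    (hg : DifferentiableAt ℝ g ρ) (a b : ℝ) (j : Fin m) :
    pd (fun x => a - b * g x) j ρ = -(b * pd g j ρ) := by
  unfold pd
  rw [fderiv_const_sub, fderiv_const_mul hg]
  simp

lemma differentiable_pd {m : ℕ} {φ : (Fin m → ℝ) → ℝ} (hφ : ContDiff ℝ (⊤ : ℕ∞) φ)
    (j : Fin m) : Differentiable ℝ (pd φ j) := by
  have h : ContDiff ℝ (⊤ : ℕ∞) (fderiv ℝ φ) := hφ.fderiv_right le_rfl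
  exact (h.differentiable (by simp)).clm_apply (differentiable_const _)

lemma differentiable_wt {m : ℕ} (P : Set (Fin m → ℝ)) {φ : (Fin m → ℝ) → ℝ}
    (hφ : Differentiable ℝ φ) (k : ℕ) (α : Fin m → ℤ) : Differentiable ℝ (wt P φ k α) := by
  unfold wt
  split_ifs
  · exact (((differentiable_dotp fun i => (α i : ℝ)).sub (hφ.const_mul (k : ℝ))).exp).mul_const _
  · exact differentiable_const _

lemma pd_wt {m : ℕ} (P : Set (Fin m → ℝ)) {φ : (Fin m → ℝ) → ℝ}
    (hφ : Differentiable ℝ φ) (k : ℕ) (α : Fin m → ℤ) (j : Fin m) (ρ : Fin m → ℝ) :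
    pd (wt P φ k α) j ρ = (α j - k * pd φ j ρ) * wt P φ k α ρ := by
  have hd := (differentiable_dotp (fun i => (α i : ℝ))) ρ
  have h := ((hd.hasFDerivAt.sub ((hφ ρ).hasFDerivAt.const_mul (k : ℝ))).exp).mul_const
    (Qk φ k α)⁻¹
  have hp := pd_dotp (fun i => (α i : ℝ)) j ρ
  unfold pd at hp ⊢
  unfold wt
  split_ifs
  · simp only [div_eq_mul_inv]
    refine (congrArg (fun L : (Fin m → ℝ) →L[ℝ] ℝ => L (Pi.single j 1)) h.fderiv).trans ?_
    simp [hp]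
    ring
  · simp

lemma wt_nonneg {m : ℕ} (P : Set (Fin m → ℝ)) {φ : (Fin m → ℝ) → ℝ}
    (hφ : ∀ ρ : Fin m → ℝ, (hess φ ρ).PosDef) (k : ℕ) (α : Fin m → ℤ) (ρ : Fin m → ℝ) :
    0 ≤ wt P φ k α ρ := by
  unfold wt
  split_ifs
  · exact div_nonneg (Real.exp_pos _).le
      (integral_nonneg fun x => mul_nonneg (Real.exp_pos _).le (hφ x).det_pos.le)
  · exact le_rfl

lemma finite_lpt_mem {m : ℕ} {P : Set (Fin m → ℝ)} (hP : Bornology.IsBounded P) {k : ℕ}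
    (hk : 1 ≤ k) : {α : Fin m → ℤ | lpt k α ∈ P}.Finite := by
  obtain ⟨R, hR⟩ := hP.exists_norm_le
  have hk0 : (0 : ℝ) < k := by exact_mod_cast hk
  refine (Set.finite_Icc (fun _ : Fin m => -⌈R * k⌉) (fun _ => ⌈R * k⌉)).subset fun α hα => ?_
  have key : ∀ i, |(α i : ℝ)| ≤ ⌈R * k⌉ := fun i => by
    have h := (norm_le_pi_norm (lpt k α) i).trans (hR _ hα)
    rw [lpt, Real.norm_eq_abs, abs_div, Nat.abs_cast, div_le_iff₀ hk0] at h
    exact h.trans (Int.le_ceil _)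
  have key' : ∀ i, |α i| ≤ ⌈R * k⌉ := fun i => by exact_mod_cast key i
  exact ⟨fun i => (abs_le.1 (key' i)).1, fun i => (abs_le.1 (key' i)).2⟩

/-- The second moments of the Bergman weights, in terms of the second derivatives of the density of
states. -/
lemma sum_wt_mul_sq {m : ℕ} {P : Set (Fin m → ℝ)} {φ : (Fin m → ℝ) → ℝ}
    (hφ : ContDiff ℝ (⊤ : ℕ∞) φ) {k : ℕ} {S : Finset (Fin m → ℤ)}
    (hS : ∀ α ∉ S, ∀ ρ, wt P φ k α ρ = 0) (j : Fin m) (ρ : Fin m → ℝ) :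
    ∑ α ∈ S, wt P φ k α ρ * (α j - k * pd φ j ρ) ^ 2 =
      pd (fun ρ' => pd (dos P φ k) j ρ') j ρ + k * pd (pd φ j) j ρ * dos P φ k ρ := by
  have hφd : Differentiable ℝ φ := hφ.differentiable (by simp)
  have hdos : dos P φ k = fun ρ => ∑ α ∈ S, wt P φ k α ρ :=
    funext fun x => tsum_eq_sum fun α hα => hS α hα x
  have hw := fun α => differentiable_wt P hφd k α
  have hp := differentiable_pd hφ j
  have hl : ∀ α : Fin m → ℤ, Differentiable ℝ fun x => (α j : ℝ) - k * pd φ j x :=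
    fun α => (hp.const_mul _).const_sub _
  have h1 : (fun ρ' => pd (dos P φ k) j ρ') =
      fun x => ∑ α ∈ S, (α j - k * pd φ j x) * wt P φ k α x := by
    ext x
    rw [hdos, pd_sum fun α _ => hw α x]
    exact Finset.sum_congr rfl fun α _ => pd_wt P hφd k α j x
  rw [h1, pd_sum fun α _ => (hl α ρ).fun_mul (hw α ρ), hdos, Finset.mul_sum,
    ← Finset.sum_add_distrib]
  refine Finset.sum_congr rfl fun α _ => ?_
  rw [pd_mul (hl α ρ) (hw α ρ), pd_wt P hφd, pd_const_sub_const_mul (hp ρ)]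
  ring

/-- A continuous function on a compact set is dominated near a point of it by a small constant plus
a multiple of the squared distance to that point. -/
lemma exists_abs_sub_le_add_mul_sum_sq {m : ℕ} {P : Set (Fin m → ℝ)} (hP : IsCompact P)
    {f : (Fin m → ℝ) → ℝ} (hf : ContinuousOn f P) {x₀ : Fin m → ℝ} (hx₀ : x₀ ∈ P) {ε : ℝ}
    (hε : 0 < ε) :
    ∃ K, 0 ≤ K ∧ ∀ x ∈ P, |f x - f x₀| ≤ ε + K * ∑ j, (x j - x₀ j) ^ 2 := by
  obtain ⟨M, hM⟩ := hP.exists_bound_of_continuousOn hf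
  have hM0 : 0 ≤ M := (norm_nonneg _).trans (hM x₀ hx₀)
  obtain ⟨δ, hδ, h⟩ := Metric.continuousOn_iff.1 hf x₀ hx₀ ε hε
  refine ⟨2 * M / δ ^ 2, by positivity, fun x hx => ?_⟩
  have hs : 0 ≤ ∑ j, (x j - x₀ j) ^ 2 := Finset.sum_nonneg fun j _ => sq_nonneg _
  by_cases hd : dist x x₀ < δ
  · have h1 := h x hx hd
    rw [Real.dist_eq] at h1
    have : 0 ≤ 2 * M / δ ^ 2 * ∑ j, (x j - x₀ j) ^ 2 := by positivity
    linarith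
  · obtain ⟨j, hj⟩ : ∃ j, δ ≤ |x j - x₀ j| := by
      by_contra! hlt
      exact hd ((dist_pi_lt_iff hδ).2 fun j => by rw [Real.dist_eq]; exact hlt j)
    have h2 : δ ^ 2 ≤ ∑ j, (x j - x₀ j) ^ 2 := by
      refine le_trans ?_ (Finset.single_le_sum (f := fun j => (x j - x₀ j) ^ 2)
        (fun j _ => sq_nonneg _) (Finset.mem_univ j))
      rw [← sq_abs (x j - x₀ j)]
      gcongr
    have h3 : 2 * M ≤ 2 * M / δ ^ 2 * ∑ j, (x j - x₀ j) ^ 2 := by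
      calc 2 * M = 2 * M / δ ^ 2 * δ ^ 2 := by field_simp
        _ ≤ _ := by gcongr
    have h4 : |f x - f x₀| ≤ |f x| + |f x₀| := abs_sub _ _
    have h5 := hM x hx
    have h6 := hM x₀ hx₀
    rw [Real.norm_eq_abs] at h5 h6
    linarith

/-- law of large numbers: `μ_k^ρ → δ_{∇φ(ρ)}` weakly. -/
theorem law_of_large_numbers {m : ℕ}
    (P : Set (Fin m → ℝ)) (hPcpt : IsCompact P) (hPconv : Convex ℝ P)
    (hPint : (interior P).Nonempty)
    (φ : (Fin m → ℝ) → ℝ) (hφ : ContDiff ℝ (⊤ : ℕ∞) φ)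
    (hφpos : ∀ ρ : Fin m → ℝ, (hess φ ρ).PosDef)
    (hφbij : Set.BijOn (gradMap φ) Set.univ (interior P))
    (hQfin : ∀ k : ℕ, 1 ≤ k → ∀ α : Fin m → ℤ, lpt k α ∈ P →
      Integrable (fun ρ : Fin m → ℝ =>
        Real.exp (dotp (fun i => (α i : ℝ)) ρ - k * φ ρ) * (hess φ ρ).det))
    (ρ : Fin m → ℝ) (c C : ℝ) (hc : 0 < c) (hC : 0 < C)
    (hlow : ∀ k : ℕ, 1 ≤ k → c * (k : ℝ) ^ m ≤ dos P φ k ρ)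
    (hder : ∀ k : ℕ, 1 ≤ k → ∀ j : Fin m, |pd (dos P φ k) j ρ| ≤ C * (k : ℝ) ^ m)
    (hder2 : ∀ k : ℕ, 1 ≤ k → ∀ i j : Fin m,
      |pd (fun ρ' => pd (dos P φ k) j ρ') i ρ| ≤ C * (k : ℝ) ^ m) :
    ∀ f : (Fin m → ℝ) → ℝ, ContinuousOn f P →
      Tendsto (fun k : ℕ => (dos P φ k ρ)⁻¹ * ∑' α : Fin m → ℤ, wt P φ k α ρ * f (lpt k α))
        atTop (𝓝 (f (gradMap φ ρ))) := by
  intro f hf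
  set x₀ := gradMap φ ρ with hx₀def
  have hx₀ : x₀ ∈ P := interior_subset (hφbij.mapsTo (Set.mem_univ ρ))
  set A : ℝ := ∑ j : Fin m, (C / c + pd (pd φ j) j ρ) with hA
  have main : ∀ ε K : ℝ, 0 ≤ K →
      (∀ x ∈ P, |f x - f x₀| ≤ ε + K * ∑ j, (x j - x₀ j) ^ 2) → ∀ k : ℕ, 1 ≤ k →
      |(dos P φ k ρ)⁻¹ * ∑' α : Fin m → ℤ, wt P φ k α ρ * f (lpt k α) - f x₀| ≤
        ε + K * A / k := by
    intro ε K hK hfK k hk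
    have hk1 : (1 : ℝ) ≤ k := by exact_mod_cast hk
    have hk0 : (0 : ℝ) < k := by linarith
    have hfin := finite_lpt_mem hPcpt.isBounded hk
    set S := hfin.toFinset with hSdef
    have hmem : ∀ α ∈ S, lpt k α ∈ P := fun α hα => by simpa [hSdef] using hα
    have hS : ∀ α ∉ S, ∀ x, wt P φ k α x = 0 := fun α hα x => by
      rw [wt, if_neg]
      simpa [hSdef] using hα
    set D := dos P φ k ρ with hD
    have hDlow : c * (k : ℝ) ^ m ≤ D := hlow k hk
    have hD0 : 0 < D := lt_of_lt_of_le (by positivity) hDlow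
    have hDsum : D = ∑ α ∈ S, wt P φ k α ρ := tsum_eq_sum fun α hα => hS α hα ρ
    have hCD : C * (k : ℝ) ^ m ≤ C / c * D := by
      calc C * (k : ℝ) ^ m = C / c * (c * (k : ℝ) ^ m) := by field_simp
        _ ≤ _ := by gcongr
    have hvar : ∀ j, ∑ α ∈ S, wt P φ k α ρ * (lpt k α j - x₀ j) ^ 2 ≤
        D * ((C / c + pd (pd φ j) j ρ) / k) := by
      intro j
      have h1 := sum_wt_mul_sq hφ hS j ρ
      have h2 := (le_abs_self _).trans (hder2 k hk j j)
      have h3 : ∑ α ∈ S, wt P φ k α ρ * (lpt k α j - x₀ j) ^ 2 =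
          (∑ α ∈ S, wt P φ k α ρ * (α j - k * pd φ j ρ) ^ 2) / k ^ 2 := by
        rw [Finset.sum_div]
        refine Finset.sum_congr rfl fun α _ => ?_
        simp only [lpt, hx₀def, gradMap]
        field_simp
      rw [h3, h1, div_le_iff₀ (by positivity)]
      have h4 : C / c * D ≤ k * (C / c * D) := le_mul_of_one_le_left (by positivity) hk1
      have h5 : D * ((C / c + pd (pd φ j) j ρ) / k) * k ^ 2 =
          k * (C / c * D) + k * pd (pd φ j) j ρ * D := by
        field_simp
      linarith
    have hdiff : D⁻¹ * ∑' α : Fin m → ℤ, wt P φ k α ρ * f (lpt k α) - f x₀ =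
        D⁻¹ * ∑ α ∈ S, wt P φ k α ρ * (f (lpt k α) - f x₀) := by
      rw [tsum_eq_sum (s := S) fun α hα => by rw [hS α hα ρ, zero_mul]]
      simp only [mul_sub, Finset.sum_sub_distrib]
      rw [← Finset.sum_mul, ← hDsum, inv_mul_cancel_left₀ hD0.ne']
    rw [hdiff, abs_mul, abs_of_pos (inv_pos.2 hD0), inv_mul_le_iff₀ hD0]
    calc |∑ α ∈ S, wt P φ k α ρ * (f (lpt k α) - f x₀)|
        ≤ ∑ α ∈ S, |wt P φ k α ρ * (f (lpt k α) - f x₀)| := Finset.abs_sum_le_sum_abs _ _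
      _ ≤ ∑ α ∈ S, wt P φ k α ρ * (ε + K * ∑ j, (lpt k α j - x₀ j) ^ 2) := by
        refine Finset.sum_le_sum fun α hα => ?_
        have h0 := wt_nonneg P hφpos k α ρ
        rw [abs_mul, abs_of_nonneg h0]
        exact mul_le_mul_of_nonneg_left (hfK _ (hmem α hα)) h0
      _ = D * ε + K * ∑ j, ∑ α ∈ S, wt P φ k α ρ * (lpt k α j - x₀ j) ^ 2 := by
        rw [Finset.sum_comm, hDsum, Finset.sum_mul, Finset.mul_sum, ← Finset.sum_add_distrib]
        refine Finset.sum_congr rfl fun α _ => ?_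
        rw [← Finset.mul_sum]
        ring
      _ ≤ D * ε + K * ∑ j, D * ((C / c + pd (pd φ j) j ρ) / k) := by
        gcongr with j
        exact hvar j
      _ = D * (ε + K * A / k) := by
        rw [← Finset.mul_sum, ← Finset.sum_div, ← hA]
        ring
  rw [Metric.tendsto_atTop]
  intro ε hε
  obtain ⟨K, hK, hfK⟩ := exists_abs_sub_le_add_mul_sum_sq hPcpt hf hx₀ (half_pos hε)
  have hlim : Tendsto (fun k : ℕ => K * A / (k : ℝ)) atTop (𝓝 0) :=
    tendsto_const_div_atTop_nhds_zero_nat _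
  obtain ⟨N, hN⟩ := eventually_atTop.1
    ((hlim.eventually_lt_const (half_pos hε)).and (eventually_ge_atTop 1))
  refine ⟨N, fun k hk => ?_⟩
  rw [Real.dist_eq]
  have h1 := main (ε / 2) K hK hfK k (hN k hk).2
  have h2 := (hN k hk).1
  linarith
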